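/- arXiv:2405.07625 — 11 statements merged into one kernel-verified Lean document; each statement's English description precedes it below -/
import Mathlib

section
/- For every integer d ≥ 1, the real number d² − 1 is the least element of the set { Re(tr β) : β ∈ M_d, β Hermitian, and −Φ + (1/d)·(I ⊗ I) + β ⊗ I is PSD }. (This is the exact value of the SDP lower bound for unitary inversion at any base point U₀.) -/
open Matrix
open scoped Kronecker ComplexOrder

/-- `Φ = |I⟩⟩⟨⟨I|`, the unnormalized maximally entangled projector. -/
noncomputable def PhiMat (d : ℕ) : Matrix (Fin d × Fin d) (Fin d × Fin d) ℂ :=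
  Matrix.of fun p q =>
    (if p.1 = p.2 then (1 : ℂ) else 0) * (if q.1 = q.2 then (1 : ℂ) else 0)

theorem PhiMat_eq_vecMulVec (d : ℕ) :
    PhiMat d = vecMulVec (fun p : Fin d × Fin d => if p.1 = p.2 then (1 : ℂ) else 0)
      (fun p : Fin d × Fin d => if p.1 = p.2 then (1 : ℂ) else 0) := rfl

theorem PhiMat_isHermitian (d : ℕ) : (PhiMat d).IsHermitian := by
  ext p q
  simp [PhiMat, apply_ite (star : ℂ → ℂ), ← ite_and, and_comm]

theorem PhiMat_mul_self (d : ℕ) : PhiMat d * PhiMat d = (d : ℂ) • PhiMat d := by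
  have h : (fun p : Fin d × Fin d => if p.1 = p.2 then (1 : ℂ) else 0) ⬝ᵥ
      (fun p : Fin d × Fin d => if p.1 = p.2 then (1 : ℂ) else 0) = d := by
    simp [dotProduct, Fintype.sum_prod_type]
  rw [PhiMat_eq_vecMulVec, vecMulVec_mul_vecMulVec, h, vecMulVec_smul]

/-- `d • 1 - Φ` is positive semidefinite, being `d` times a projector. -/
theorem smul_one_sub_PhiMat_posSemidef (d : ℕ) (hd : 1 ≤ d) :
    ((d : ℂ) • (1 : Matrix (Fin d × Fin d) (Fin d × Fin d) ℂ) - PhiMat d).PosSemidef := by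
  have hd0 : (d : ℂ) ≠ 0 := by exact_mod_cast (by omega : d ≠ 0)
  have hH : ((d : ℂ) • (1 : Matrix (Fin d × Fin d) (Fin d × Fin d) ℂ) - PhiMat d)ᴴ =
      (d : ℂ) • 1 - PhiMat d := by
    rw [conjTranspose_sub, (PhiMat_isHermitian d).eq, conjTranspose_smul]
    simp
  have hsq : (d : ℂ) • (1 : Matrix (Fin d × Fin d) (Fin d × Fin d) ℂ) - PhiMat d =
      (d : ℂ)⁻¹ • (((d : ℂ) • 1 - PhiMat d)ᴴ * ((d : ℂ) • 1 - PhiMat d)) := by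
    rw [hH, eq_inv_smul_iff₀ hd0]
    simp [sub_mul, mul_sub, PhiMat_mul_self, smul_sub]
  rw [hsq]
  refine (posSemidef_conjTranspose_mul_self _).smul ?_
  rw [← Complex.ofReal_natCast, ← Complex.ofReal_inv, Complex.zero_le_real]
  positivity

/-- The quadratic form of the SDP constraint at the maximally entangled vector. -/
theorem maxEntangled_quadraticForm (d : ℕ) (hd : 1 ≤ d) (β : Matrix (Fin d) (Fin d) ℂ) :
    star (fun p : Fin d × Fin d => if p.1 = p.2 then (1 : ℂ) else 0) ⬝ᵥ
      (-(PhiMat d) + ((1 : ℂ)/d) • ((1 : Matrix (Fin d) (Fin d) ℂ) ⊗ₖ 1)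
          + β ⊗ₖ (1 : Matrix (Fin d) (Fin d) ℂ)) *ᵥ
        (fun p : Fin d × Fin d => if p.1 = p.2 then (1 : ℂ) else 0) =
      -(d : ℂ) ^ 2 + 1 + β.trace := by
  have hd0 : (d : ℂ) ≠ 0 := by exact_mod_cast (by omega : d ≠ 0)
  simp [dotProduct, mulVec, Fintype.sum_prod_type, PhiMat, Matrix.one_apply, trace,
    Finset.sum_add_distrib, hd0, apply_ite (star : ℂ → ℂ)]
  ring

theorem sdp_value_unitary_inversion (d : ℕ) (hd : 1 ≤ d) :
    IsLeast { t : ℝ | ∃ β : Matrix (Fin d) (Fin d) ℂ, β.IsHermitian ∧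
        (-(PhiMat d) + ((1 : ℂ)/d) • ((1 : Matrix (Fin d) (Fin d) ℂ) ⊗ₖ 1)
          + β ⊗ₖ (1 : Matrix (Fin d) (Fin d) ℂ)).PosSemidef ∧
        t = (β.trace).re }
      ((d : ℝ)^2 - 1) := by
  have hd0 : (d : ℝ) ≠ 0 := by exact_mod_cast (by omega : d ≠ 0)
  refine ⟨⟨((d - 1 / d : ℝ) : ℂ) • 1, ?_, ?_, ?_⟩, ?_⟩
  · rw [IsHermitian, conjTranspose_smul, conjTranspose_one, Complex.star_def, Complex.conj_ofReal]
  · convert smul_one_sub_PhiMat_posSemidef d hd using 1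
    rw [smul_kronecker, one_kronecker_one, add_assoc, ← add_smul, neg_add_eq_sub]
    congr 2
    push_cast
    ring
  · rw [trace_smul, trace_one, Fintype.card_fin, smul_eq_mul, ← Complex.ofReal_natCast,
      ← Complex.ofReal_mul, Complex.ofReal_re]
    field_simp
  · rintro t ⟨β, -, hpsd, rfl⟩
    have h := hpsd.dotProduct_mulVec_nonneg
      (fun p : Fin d × Fin d => if p.1 = p.2 then (1 : ℂ) else 0)
    rw [maxEntangled_quadraticForm d hd β] at h
    have hre := (Complex.le_def.mp h).1
    have hcast : ((d : ℂ) ^ 2).re = (d : ℝ) ^ 2 := by norm_cast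
    simp only [Complex.add_re, Complex.neg_re, Complex.zero_re, Complex.one_re, hcast] at hre
    linarith
end

section
/- For every integer d ≥ 2, the real number d + 1 is the least element of the set { Re(tr β) : β ∈ M_d, β Hermitian, and SWAP − (1/d)·(I ⊗ I) + β ⊗ I is PSD }. (This is the exact value of the SDP lower bound for unitary transposition at any base point U₀.) -/
open Matrix
open scoped Kronecker ComplexOrder

/-- The SWAP operator on `ℂ^d ⊗ ℂ^d`. -/
noncomputable def SwapMat (d : ℕ) : Matrix (Fin d × Fin d) (Fin d × Fin d) ℂ :=
  Matrix.of fun p q =>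
    (if p.1 = q.2 then (1 : ℂ) else 0) * (if p.2 = q.1 then (1 : ℂ) else 0)

theorem SwapMat_conjTranspose (d : ℕ) : (SwapMat d)ᴴ = SwapMat d := by
  ext p q
  simp only [SwapMat, conjTranspose_apply, of_apply, star_mul', apply_ite star, star_one, star_zero]
  rw [mul_comm]
  simp only [eq_comm]

theorem SwapMat_mul_self (d : ℕ) : SwapMat d * SwapMat d = 1 := by
  ext ⟨i, j⟩ ⟨k, l⟩
  simp [SwapMat, mul_apply, Fintype.sum_prod_type, one_apply, Prod.ext_iff, ite_and]
  split_ifs <;> rfl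

theorem trace_kronecker_one_mul_SwapMat (d : ℕ) (A : Matrix (Fin d) (Fin d) ℂ) :
    (A ⊗ₖ (1 : Matrix (Fin d) (Fin d) ℂ) * SwapMat d).trace = A.trace := by
  simp [SwapMat, trace, mul_apply, Fintype.sum_prod_type, one_apply]

theorem trace_SwapMat (d : ℕ) : (SwapMat d).trace = d := by
  simpa using trace_kronecker_one_mul_SwapMat d 1

theorem posSemidef_SwapMat_add_one (d : ℕ) : (SwapMat d + 1).PosSemidef := by
  have h := (posSemidef_conjTranspose_mul_self (SwapMat d + 1)).smul
    (show (0 : ℝ) ≤ 1 / 2 by norm_num)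
  convert h using 1
  rw [conjTranspose_add, SwapMat_conjTranspose, conjTranspose_one, add_mul, mul_add,
    SwapMat_mul_self, mul_one, one_mul]
  module

/-- Pairing a positive semidefinite matrix with twice the antisymmetric projector `1 - SWAP`. -/
theorem trace_mul_one_sub_SwapMat_nonneg {d : ℕ} {M : Matrix (Fin d × Fin d) (Fin d × Fin d) ℂ}
    (hM : M.PosSemidef) : 0 ≤ (M * (1 - SwapMat d)).trace.re := by
  have h := (hM.conjTranspose_mul_mul_same (1 - SwapMat d)).trace_nonneg
  have hsq : (1 - SwapMat d) * (1 - SwapMat d) = (2 : ℂ) • (1 - SwapMat d) := by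
    rw [sub_mul, one_mul, mul_sub, SwapMat_mul_self, mul_one]
    module
  rw [conjTranspose_sub, SwapMat_conjTranspose, conjTranspose_one, mul_assoc, trace_mul_comm,
    mul_assoc, hsq, mul_smul_comm, trace_smul] at h
  have h' := (Complex.le_def.mp h).1
  simp only [smul_eq_mul, Complex.mul_re, Complex.zero_re, Complex.re_ofNat, Complex.im_ofNat,
    zero_mul, sub_zero] at h'
  linarith

theorem sdp_value_unitary_transposition (d : ℕ) (hd : 2 ≤ d) :
    IsLeast { t : ℝ | ∃ β : Matrix (Fin d) (Fin d) ℂ, β.IsHermitian ∧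
        (SwapMat d - ((1 : ℂ)/d) • ((1 : Matrix (Fin d) (Fin d) ℂ) ⊗ₖ 1)
          + β ⊗ₖ (1 : Matrix (Fin d) (Fin d) ℂ)).PosSemidef ∧
        t = (β.trace).re }
      ((d : ℝ) + 1) := by
  have hd2 : (2 : ℝ) ≤ d := by exact_mod_cast hd
  have hd0 : (d : ℂ) ≠ 0 := by
    have : d ≠ 0 := by omega
    exact_mod_cast this
  constructor
  · refine ⟨((1 + 1 / d : ℝ) : ℂ) • 1, ?_, ?_, ?_⟩
    · rw [IsHermitian, conjTranspose_smul, conjTranspose_one]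
      simp
    · convert posSemidef_SwapMat_add_one d using 1
      rw [smul_kronecker, one_kronecker_one]
      push_cast
      module
    · rw [trace_smul, trace_one, Fintype.card_fin, smul_eq_mul, ← Complex.ofReal_natCast,
        ← Complex.ofReal_mul, Complex.ofReal_re]
      field_simp
  · rintro t ⟨β, -, hM, rfl⟩
    have h := trace_mul_one_sub_SwapMat_nonneg hM
    have key : ((SwapMat d - ((1 : ℂ)/d) • ((1 : Matrix (Fin d) (Fin d) ℂ) ⊗ₖ 1)
        + β ⊗ₖ (1 : Matrix (Fin d) (Fin d) ℂ)) * (1 - SwapMat d)).trace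
        = ((d - 1 : ℝ) : ℂ) * (β.trace - ((d + 1 : ℝ) : ℂ)) := by
      rw [one_kronecker_one, mul_sub, mul_one, add_mul, sub_mul, SwapMat_mul_self, smul_mul_assoc,
        one_mul]
      simp only [trace_sub, trace_add, trace_smul, trace_SwapMat, trace_kronecker,
        trace_kronecker_one_mul_SwapMat, trace_one, Fintype.card_prod, Fintype.card_fin,
        smul_eq_mul]
      push_cast
      field_simp
      ring
    rw [key, Complex.re_ofReal_mul, Complex.sub_re, Complex.ofReal_re] at h
    have := nonneg_of_mul_nonneg_right h (by linarith)
    linarith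
end

section
/- Let d ≥ 1 be an integer and β ∈ M_d be Hermitian. If β ⊗ I − Φ is PSD, then Re(tr β) ≥ d². (This is the key step in the strengthening of the unitary-inversion lower bound from d² − 1 to d².) -/
open Matrix
open scoped Kronecker ComplexOrder

/-- The quadratic form of `β ⊗ I` at `|I⟩⟩` is the trace of `β`. -/
theorem dotProduct_kronecker_one_mulVec_diagonal {n : Type*} [Fintype n] [DecidableEq n]
    (β : Matrix n n ℂ) :
    (fun p : n × n => if p.1 = p.2 then (1 : ℂ) else 0) ⬝ᵥ
      ((β ⊗ₖ (1 : Matrix n n ℂ)) *ᵥ fun p => if p.1 = p.2 then (1 : ℂ) else 0) = β.trace := by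
  simp [dotProduct, mulVec, Fintype.sum_prod_type, Matrix.one_apply, Matrix.trace]

/-- The quadratic form of `Φ` at `|I⟩⟩` is `d²`. -/
theorem dotProduct_phiMat_mulVec_diagonal (d : ℕ) :
    (fun p : Fin d × Fin d => if p.1 = p.2 then (1 : ℂ) else 0) ⬝ᵥ
      (PhiMat d *ᵥ fun p => if p.1 = p.2 then (1 : ℂ) else 0) = (d : ℂ) ^ 2 := by
  simp [dotProduct, mulVec, Fintype.sum_prod_type, PhiMat, sq]

theorem inversion_lower_bound_strengthening (d : ℕ) (hd : 1 ≤ d)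
    (β : Matrix (Fin d) (Fin d) ℂ) (hβ : β.IsHermitian)
    (hpsd : (β ⊗ₖ (1 : Matrix (Fin d) (Fin d) ℂ) - PhiMat d).PosSemidef) :
    ((d : ℝ)^2) ≤ (β.trace).re := by
  have h := hpsd.dotProduct_mulVec_nonneg
    (fun p : Fin d × Fin d => if p.1 = p.2 then (1 : ℂ) else 0)
  have hstar : star (fun p : Fin d × Fin d => if p.1 = p.2 then (1 : ℂ) else 0) =
      fun p => if p.1 = p.2 then (1 : ℂ) else 0 := by
    ext p
    simp [apply_ite]
  rw [hstar, sub_mulVec, dotProduct_sub, dotProduct_kronecker_one_mulVec_diagonal,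
    dotProduct_phiMat_mulVec_diagonal, sub_nonneg] at h
  simpa [← Complex.ofReal_natCast, ← Complex.ofReal_pow] using (Complex.le_def.1 h).1
end

section
/- Let d ≥ 2 be an integer, N > 0 a real number, and p ∈ [0,1]. Suppose there exist a Hermitian β ∈ M_d with Re(tr β) = N and PSD d²×d² matrices J_A, J_B such that J_A − J_B = −Φ + (1/d)·(I ⊗ I) + β ⊗ I and (1 + √p)·Re(tr J_B) = (1 − √p)·Re(tr J_A). Then √p·(N·(d² − 2) + 2·(d² − 1)) ≤ N·d²; in particular p ≤ (N·d²/(N·(d² − 2) + 2·(d² − 1)))². (Upper bound on the success probability of probabilistic exact unitary inversion with N queries.) -/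
open Matrix
open scoped Kronecker ComplexOrder

/-- The sum of all entries of a positive semidefinite matrix is nonnegative. -/
theorem Matrix.PosSemidef.re_sum_entries_nonneg {n : Type*} [Fintype n]
    {M : Matrix n n ℂ} (hM : M.PosSemidef) : 0 ≤ (∑ i, ∑ j, M i j).re := by
  have h := (Complex.le_def.1 (hM.dotProduct_mulVec_nonneg (fun _ => 1))).1
  simpa [dotProduct, mulVec] using h

/-- The sum of all entries of a positive semidefinite matrix is at most its size times its trace. -/
theorem Matrix.PosSemidef.re_sum_entries_le {n : Type*} [Fintype n]
    {M : Matrix n n ℂ} (hM : M.PosSemidef) :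
    (∑ i, ∑ j, M i j).re ≤ Fintype.card n * M.trace.re := by
  classical
  have key (i j : n) : (M i j).re + (M j i).re ≤ (M i i).re + (M j j).re := by
    have h := (Complex.le_def.1
      (hM.dotProduct_mulVec_nonneg (Pi.single i 1 - Pi.single j 1))).1
    simp [mulVec_sub, sub_dotProduct, dotProduct_sub, Pi.star_single] at h
    linarith
  have h := Finset.sum_le_sum fun i (_ : i ∈ Finset.univ) =>
    Finset.sum_le_sum fun j (_ : j ∈ Finset.univ) => key i j
  simp only [Finset.sum_add_distrib] at h
  rw [Finset.sum_comm (f := fun i j => (M j i).re)] at h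
  simp only [Finset.sum_const, Finset.card_univ, nsmul_eq_mul, ← Finset.mul_sum] at h
  simp only [Matrix.trace, Matrix.diag, Complex.re_sum]
  linarith

/-- A principal submatrix of a positive semidefinite matrix has smaller trace. -/
theorem Matrix.PosSemidef.re_trace_submatrix_diag_le {n : Type*} [Fintype n]
    {J : Matrix (n × n) (n × n) ℂ} (hJ : J.PosSemidef) :
    (J.submatrix (fun i => (i, i)) (fun i => (i, i))).trace.re ≤ J.trace.re := by
  simp only [Matrix.trace, Matrix.diag, Matrix.submatrix_apply, Complex.re_sum,
    Fintype.sum_prod_type]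
  refine Finset.sum_le_sum fun i _ => ?_
  exact Finset.single_le_sum (f := fun j => (J (i, j) (i, j)).re)
    (fun j _ => (Complex.le_def.1 hJ.diag_nonneg).1) (Finset.mem_univ i)

theorem trace_PhiMat (d : ℕ) : (PhiMat d).trace = d := by
  simp [Matrix.trace, PhiMat, Fintype.sum_prod_type]

theorem prob_inversion_upper_bound (d : ℕ) (hd : 2 ≤ d)
    (N : ℝ) (hN : 0 < N) (p : ℝ) (hp0 : 0 ≤ p) (hp1 : p ≤ 1)
    (h : ∃ (β : Matrix (Fin d) (Fin d) ℂ)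
        (J_A J_B : Matrix (Fin d × Fin d) (Fin d × Fin d) ℂ),
        β.IsHermitian ∧ (β.trace).re = N ∧ J_A.PosSemidef ∧ J_B.PosSemidef ∧
        J_A - J_B = -(PhiMat d) + ((1 : ℂ)/d) • ((1 : Matrix (Fin d) (Fin d) ℂ) ⊗ₖ 1)
          + β ⊗ₖ (1 : Matrix (Fin d) (Fin d) ℂ) ∧
        (1 + Real.sqrt p) * (J_B.trace).re = (1 - Real.sqrt p) * (J_A.trace).re) :
    Real.sqrt p * (N * ((d : ℝ)^2 - 2) + 2 * ((d : ℝ)^2 - 1)) ≤ N * (d : ℝ)^2 ∧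
      p ≤ (N * (d : ℝ)^2 / (N * ((d : ℝ)^2 - 2) + 2 * ((d : ℝ)^2 - 1)))^2 := by
  obtain ⟨β, A, B, -, htr, hA, hB, hAB, hp⟩ := h
  have hd0 : (0 : ℝ) < d := by positivity
  have hdC : (d : ℂ) ≠ 0 := by exact_mod_cast hd0.ne'
  have hd2 : (2 : ℝ) ≤ d := by exact_mod_cast hd
  have htrace : A.trace.re - B.trace.re = N * d := by
    have h : A.trace - B.trace = β.trace * d := by
      rw [← Matrix.trace_sub, hAB]
      simp [trace_PhiMat, Matrix.trace_kronecker]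
      field_simp
      ring
    have h' := congrArg Complex.re h
    simpa [htr] using h'
  have hsum : (∑ i, ∑ j, A (i, i) (j, j)).re - (∑ i, ∑ j, B (i, i) (j, j)).re
      = -(d : ℝ) ^ 2 + 1 + N := by
    have h : ∑ i, ∑ j, A (i, i) (j, j) - ∑ i, ∑ j, B (i, i) (j, j)
        = -(d : ℂ) ^ 2 + 1 + β.trace := by
      simp only [← Finset.sum_sub_distrib, ← Matrix.sub_apply, hAB]
      simp [PhiMat, Matrix.one_apply, Finset.sum_add_distrib, Matrix.trace, hdC, sq]
    have h' := congrArg Complex.re h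
    simpa [htr, ← Complex.ofReal_natCast, ← Complex.ofReal_pow] using h'
  have hA0 := (hA.submatrix fun i : Fin d => (i, i)).re_sum_entries_nonneg
  have hB1 := (hB.submatrix fun i : Fin d => (i, i)).re_sum_entries_le
  have hB2 := mul_le_mul_of_nonneg_left hB.re_trace_submatrix_diag_le hd0.le
  simp only [Matrix.submatrix_apply, Fintype.card_fin] at hA0 hB1
  have hb : (d : ℝ) ^ 2 - 1 - N ≤ d * B.trace.re := by linarith
  have hs := Real.sqrt_nonneg p
  have hmain : √p * (N * ((d : ℝ) ^ 2 - 2) + 2 * ((d : ℝ) ^ 2 - 1)) ≤ N * (d : ℝ) ^ 2 := by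
    calc √p * (N * ((d : ℝ) ^ 2 - 2) + 2 * ((d : ℝ) ^ 2 - 1))
        ≤ √p * (d * (A.trace.re + B.trace.re)) :=
          mul_le_mul_of_nonneg_left (by linear_combination 2 * hb - d * htrace) hs
      _ = N * (d : ℝ) ^ 2 := by linear_combination d * hp + d * htrace
  refine ⟨hmain, ?_⟩
  have hden : 0 < N * ((d : ℝ) ^ 2 - 2) + 2 * ((d : ℝ) ^ 2 - 1) := by
    have h2 : 0 < (d : ℝ) ^ 2 - 2 := by nlinarith
    have h1 : 0 < (d : ℝ) ^ 2 - 1 := by linarith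
    positivity
  calc p = √p ^ 2 := (Real.sq_sqrt hp0).symm
    _ ≤ _ := pow_le_pow_left₀ hs ((le_div_iff₀ hden).2 hmain) 2
end

section
/- Let d ≥ 2 be an integer, N a real number with 0 < N ≤ d − 1, p ∈ [0,1], and U₀ ∈ U(d) a unitary. Suppose there exist a Hermitian β ∈ M_d with Re(tr β) = N and PSD d²×d² matrices J_A, J_B such that J_A − J_B = −(I ⊗ U₀ᵀ)·(SWAP − (1/d)·(I ⊗ I))·(I ⊗ U₀*) + β ⊗ I and (1 + √p)·Re(tr J_B) = (1 − √p)·Re(tr J_A). Then √p·(d² − 1 − N) ≤ N·d. (Upper bound on the success probability of probabilistic exact unitary complex conjugation with N queries.) -/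
open Matrix
open scoped Kronecker ComplexOrder

theorem SwapMat_apply_eq (d : ℕ) (p q : Fin d × Fin d) :
    SwapMat d p q = if p = q.swap then 1 else 0 := by
  simp only [SwapMat, Matrix.of_apply, Prod.ext_iff, Prod.fst_swap, Prod.snd_swap]
  split_ifs <;> simp_all

theorem SwapMat_mul_apply (d : ℕ) (A : Matrix (Fin d × Fin d) (Fin d × Fin d) ℂ)
    (p q : Fin d × Fin d) : (SwapMat d * A) p q = A p.swap q := by
  have hswap : ∀ r : Fin d × Fin d, (p = r.swap) = (p.swap = r) := fun r =>
    propext ⟨fun hr => by rw [hr, Prod.swap_swap], fun hr => by rw [← hr, Prod.swap_swap]⟩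
  simp [Matrix.mul_apply, SwapMat_apply_eq, hswap]

theorem trace_SwapMat_mul_kronecker_one (d : ℕ) (β : Matrix (Fin d) (Fin d) ℂ) :
    (SwapMat d * (β ⊗ₖ (1 : Matrix (Fin d) (Fin d) ℂ))).trace = β.trace := by
  simp only [Matrix.trace, Matrix.diag_apply, SwapMat_mul_apply, Matrix.kroneckerMap_apply,
    Fintype.sum_prod_type, Prod.fst_swap, Prod.snd_swap, Matrix.one_apply]
  simp

/-- A Hermitian involution `W` satisfies `W ≤ 1`, hence `tr (W J) ≤ tr J` for `J ≥ 0`. -/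
theorem Matrix.PosSemidef.re_trace_involution_mul_le {n : Type*} [Fintype n] [DecidableEq n]
    {J W : Matrix n n ℂ} (hJ : J.PosSemidef) (hW : Wᴴ = W) (hWW : W * W = 1) :
    (W * J).trace.re ≤ J.trace.re := by
  have h0 := (Complex.le_def.1 (hJ.mul_mul_conjTranspose_same (1 - W)).trace_nonneg).1
  have h1 : ((1 - W) * J * (1 - W)ᴴ).trace = 2 * (J.trace - (W * J).trace) := by
    have h2 : (1 - W) * (1 - W) = 1 - W - W + 1 := by
      rw [Matrix.mul_sub, Matrix.mul_one, Matrix.sub_mul, hWW, Matrix.one_mul]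
      abel
    rw [Matrix.conjTranspose_sub, Matrix.conjTranspose_one, hW, Matrix.trace_mul_comm,
      ← Matrix.mul_assoc, h2]
    simp only [Matrix.add_mul, Matrix.sub_mul, Matrix.one_mul, Matrix.trace_add,
      Matrix.trace_sub]
    ring
  rw [h1] at h0
  simp at h0
  linarith

theorem prob_conjugation_upper_bound (d : ℕ) (hd : 2 ≤ d)
    (N : ℝ) (hN : 0 < N) (hNd : N ≤ (d : ℝ) - 1)
    (p : ℝ) (hp0 : 0 ≤ p) (hp1 : p ≤ 1)
    (U₀ : Matrix.unitaryGroup (Fin d) ℂ)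
    (h : ∃ (β : Matrix (Fin d) (Fin d) ℂ)
        (J_A J_B : Matrix (Fin d × Fin d) (Fin d × Fin d) ℂ),
        β.IsHermitian ∧ (β.trace).re = N ∧ J_A.PosSemidef ∧ J_B.PosSemidef ∧
        J_A - J_B =
          -(((1 : Matrix (Fin d) (Fin d) ℂ) ⊗ₖ (U₀ : Matrix (Fin d) (Fin d) ℂ)ᵀ)
              * (SwapMat d - ((1 : ℂ)/d) • ((1 : Matrix (Fin d) (Fin d) ℂ) ⊗ₖ 1))
              * ((1 : Matrix (Fin d) (Fin d) ℂ)
                  ⊗ₖ ((U₀ : Matrix (Fin d) (Fin d) ℂ).map (starRingEnd ℂ))))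
            + β ⊗ₖ (1 : Matrix (Fin d) (Fin d) ℂ) ∧
        (1 + Real.sqrt p) * (J_B.trace).re = (1 - Real.sqrt p) * (J_A.trace).re) :
    Real.sqrt p * ((d : ℝ)^2 - 1 - N) ≤ N * d := by
  obtain ⟨β, A, B, -, hβ, hA, hB, hAB, hp⟩ := h
  have hd0 : (d : ℂ) ≠ 0 := Nat.cast_ne_zero.2 (by omega)
  set U : Matrix (Fin d) (Fin d) ℂ := (U₀ : Matrix (Fin d) (Fin d) ℂ)
  have hconj : U.map (starRingEnd ℂ) = Uᵀᴴ := by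
    ext i j
    simp [Matrix.conjTranspose_apply]
  have hU1 : Uᵀ * Uᵀᴴ = 1 := by
    change Uᵀ * Uᴴᵀ = 1
    rw [← Matrix.transpose_mul, ← Matrix.star_eq_conjTranspose, Matrix.mem_unitaryGroup_iff'.1 U₀.2, Matrix.transpose_one]
  have hU2 : Uᵀᴴ * Uᵀ = 1 := mul_eq_one_comm.1 hU1
  rw [hconj] at hAB
  set V : Matrix (Fin d × Fin d) (Fin d × Fin d) ℂ := 1 ⊗ₖ Uᵀ with hV
  have hVH : (1 : Matrix (Fin d) (Fin d) ℂ) ⊗ₖ Uᵀᴴ = Vᴴ := by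
    rw [hV, Matrix.conjTranspose_kronecker, Matrix.conjTranspose_one]
  rw [hVH, Matrix.one_kronecker_one] at hAB
  have hVV : Vᴴ * V = 1 := by
    rw [← hVH, hV, ← Matrix.mul_kronecker_mul, hU2, Matrix.one_mul, Matrix.one_kronecker_one]
  have hVV' : V * Vᴴ = 1 := mul_eq_one_comm.1 hVV
  have hVβ : Vᴴ * (β ⊗ₖ 1) * V = β ⊗ₖ 1 := by
    rw [← hVH, hV, ← Matrix.mul_kronecker_mul, ← Matrix.mul_kronecker_mul]
    simp [hU2]
  have hcancel : ∀ X Y : Matrix (Fin d × Fin d) (Fin d × Fin d) ℂ,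
      V * X * Vᴴ * (V * Y * Vᴴ) = V * (X * Y) * Vᴴ := fun X Y => by
    calc V * X * Vᴴ * (V * Y * Vᴴ) = V * X * (Vᴴ * V) * Y * Vᴴ := by
          simp only [Matrix.mul_assoc]
      _ = V * (X * Y) * Vᴴ := by rw [hVV]; simp only [Matrix.mul_assoc, Matrix.one_mul]
  have htrace : ∀ X : Matrix (Fin d × Fin d) (Fin d × Fin d) ℂ,
      (V * X * Vᴴ).trace = X.trace := fun X => by
    rw [Matrix.trace_mul_comm, ← Matrix.mul_assoc, hVV, Matrix.one_mul]
  set W := V * SwapMat d * Vᴴ with hW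
  have hWH : Wᴴ = W := by
    simp [hW, Matrix.conjTranspose_mul, SwapMat_conjTranspose, Matrix.mul_assoc]
  have hWW : W * W = 1 := by
    rw [hW, hcancel, SwapMat_mul_self, Matrix.mul_one, hVV']
  have htrAB : A.trace - B.trace = d * β.trace := by
    rw [← Matrix.trace_sub, hAB, Matrix.trace_add, Matrix.trace_neg, htrace, Matrix.trace_sub,
      Matrix.trace_smul, trace_SwapMat, Matrix.trace_kronecker]
    simp
    field_simp
    ring
  have htrW : (W * A).trace - (W * B).trace = -((d : ℂ) ^ 2 - 1) + β.trace := by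
    have hWβ : (W * (β ⊗ₖ (1 : Matrix (Fin d) (Fin d) ℂ))).trace = β.trace := by
      rw [← trace_SwapMat_mul_kronecker_one d β, hW, Matrix.mul_assoc, Matrix.mul_assoc,
        Matrix.trace_mul_comm, Matrix.mul_assoc, hVβ]
    rw [← Matrix.trace_sub, ← Matrix.mul_sub, hAB, Matrix.mul_add, Matrix.trace_add, hWβ,
      Matrix.mul_neg, Matrix.trace_neg, hW, hcancel, htrace, Matrix.mul_sub, SwapMat_mul_self,
      Matrix.trace_sub, Matrix.mul_smul, Matrix.mul_one, Matrix.trace_smul, trace_SwapMat]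
    simp
    field_simp
  have hAle := hA.re_trace_involution_mul_le (W := -W) (by simp [hWH]) (by simp [hWW])
  have hBle := hB.re_trace_involution_mul_le hWH hWW
  have h1 := congrArg Complex.re htrAB
  have h2 := congrArg Complex.re htrW
  simp [pow_two, hβ] at h1 h2 hAle
  have hs := Real.sqrt_nonneg p
  have hsum : (d : ℝ) ^ 2 - 1 - N ≤ A.trace.re + B.trace.re := by nlinarith
  nlinarith [mul_le_mul_of_nonneg_left hsum hs]
end

section
/- Let d ≥ 1 be an integer, J a nonzero Hermitian d²×d² matrix whose partial trace over the second tensor factor is zero (Σ_l J[(j,l),(k,l)] = 0 for all j, k), N > 0 a real number, and p ∈ [0,1]. Suppose there exist a Hermitian β ∈ M_d with Re(tr β) = N and PSD d²×d² matrices J_A, J_B such that J_A − J_B = J + β ⊗ I and (1 + √p)·Re(tr J_B) = (1 − √p)·Re(tr J_A). Then √p·‖J‖_F² ≤ N·d·‖J‖_op; in particular p ≤ (N·d·‖J‖_op/‖J‖_F²)². (The canonical upper bound on the success probability in terms of the SDP data.) -/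
open Matrix
open scoped Kronecker ComplexOrder

/-- Frobenius (Hilbert–Schmidt) norm of a matrix. -/
noncomputable def frobNorm {n : Type*} [Fintype n]
    (J : Matrix n n ℂ) : ℝ :=
  Real.sqrt (∑ a, ∑ b, ‖J a b‖ ^ 2)

/-- The `ℓ² → ℓ²` operator norm (largest singular value) of a matrix. -/
noncomputable def opNorm {n : Type*} [Fintype n] [DecidableEq n]
    (J : Matrix n n ℂ) : ℝ :=
  ‖(Matrix.toEuclideanCLM (𝕜 := ℂ) J :
      EuclideanSpace ℂ n →L[ℂ] EuclideanSpace ℂ n)‖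

/-- The quadratic form of a matrix is bounded by its operator norm. -/
lemma norm_star_dotProduct_mulVec_le_opNorm {n : Type*} [Fintype n] [DecidableEq n]
    (J : Matrix n n ℂ) (v : n → ℂ) :
    ‖star v ⬝ᵥ (J *ᵥ v)‖ ≤ opNorm J * (star v ⬝ᵥ v).re := by
  set x : EuclideanSpace ℂ n := WithLp.toLp 2 v with hx
  have hinner : ∀ w : n → ℂ, inner ℂ x (WithLp.toLp 2 w) = star v ⬝ᵥ w := by
    intro w
    rw [EuclideanSpace.inner_eq_star_dotProduct, dotProduct_comm]
  have hJx : Matrix.toEuclideanCLM (𝕜 := ℂ) J x = WithLp.toLp 2 (J *ᵥ v) := by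
    simp [hx]
  have hself : (star v ⬝ᵥ v).re = ‖x‖ ^ 2 := by
    rw [← hinner v, ← hx, inner_self_eq_norm_sq_to_K]
    norm_cast
  rw [← hinner, ← hJx, hself]
  calc ‖inner ℂ x (Matrix.toEuclideanCLM (𝕜 := ℂ) J x)‖
      ≤ ‖x‖ * ‖Matrix.toEuclideanCLM (𝕜 := ℂ) J x‖ := norm_inner_le_norm _ _
    _ ≤ ‖x‖ * (opNorm J * ‖x‖) := by
        gcongr
        exact ContinuousLinearMap.le_opNorm _ _
    _ = opNorm J * ‖x‖ ^ 2 := by ring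

/-- The trace pairing of a matrix with a positive semidefinite matrix is bounded by the operator
norm times the trace. -/
lemma Matrix.PosSemidef.norm_trace_mul_le {n : Type*} [Fintype n] [DecidableEq n]
    {P : Matrix n n ℂ} (hP : P.PosSemidef) (J : Matrix n n ℂ) :
    ‖(J * P).trace‖ ≤ opNorm J * P.trace.re := by
  obtain ⟨k, v, rfl⟩ := Matrix.posSemidef_iff_eq_sum_vecMulVec.mp hP
  have htrace : ∀ w : n → ℂ, (Matrix.vecMulVec w (star w)).trace = star w ⬝ᵥ w := fun w => by
    rw [Matrix.trace_vecMulVec, dotProduct_comm]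
  have hpair : ∀ w : n → ℂ,
      (J * Matrix.vecMulVec w (star w)).trace = star w ⬝ᵥ (J *ᵥ w) := fun w => by
    rw [Matrix.mul_vecMulVec, Matrix.trace_vecMulVec, dotProduct_comm]
  simp only [Matrix.trace_sum, htrace, hpair, Complex.re_sum, Finset.mul_sum]
  exact norm_sum_le_of_le _ fun i _ => norm_star_dotProduct_mulVec_le_opNorm J (v i)

/-- The squared Frobenius norm of a Hermitian matrix is the trace of its square. -/
lemma Matrix.IsHermitian.frobNorm_sq {n : Type*} [Fintype n] {J : Matrix n n ℂ}
    (hJ : J.IsHermitian) : frobNorm J ^ 2 = (J * J).trace.re := by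
  rw [frobNorm, Real.sq_sqrt (by positivity)]
  simp only [Matrix.trace, Matrix.diag_apply, Matrix.mul_apply, Complex.re_sum]
  refine Finset.sum_congr rfl fun a _ => Finset.sum_congr rfl fun b _ => ?_
  rw [← hJ.apply b a, Complex.star_def, Complex.mul_conj, Complex.normSq_eq_norm_sq,
    Complex.ofReal_re]

/-- The Frobenius norm of a nonzero matrix is positive. -/
lemma frobNorm_pos {n : Type*} [Fintype n] {J : Matrix n n ℂ} (hJ : J ≠ 0) :
    0 < frobNorm J := by
  obtain ⟨a, b, hab⟩ : ∃ a b, J a b ≠ 0 := by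
    by_contra! h
    exact hJ (Matrix.ext h)
  refine Real.sqrt_pos.mpr ?_
  refine Finset.sum_pos' (fun _ _ => by positivity) ⟨a, Finset.mem_univ a, ?_⟩
  exact Finset.sum_pos' (fun _ _ => by positivity) ⟨b, Finset.mem_univ b, by positivity⟩

/-- A matrix with vanishing partial trace over the second factor is orthogonal to every
`β ⊗ 1`. -/
lemma trace_mul_kronecker_one_eq_zero {m n : Type*} [Fintype m] [Fintype n] [DecidableEq n]
    {J : Matrix (m × n) (m × n) ℂ} (hJ : ∀ j k, ∑ l, J (j, l) (k, l) = 0) (β : Matrix m m ℂ) :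
    (J * β ⊗ₖ (1 : Matrix n n ℂ)).trace = 0 := by
  have hsum : (J * β ⊗ₖ (1 : Matrix n n ℂ)).trace
      = ∑ j, ∑ l, ∑ k, J (j, l) (k, l) * β k j := by
    simp [Matrix.trace, Matrix.mul_apply, Fintype.sum_prod_type, Matrix.one_apply]
  rw [hsum]
  refine Finset.sum_eq_zero fun j _ => ?_
  rw [Finset.sum_comm]
  refine Finset.sum_eq_zero fun k _ => ?_
  rw [← Finset.sum_mul, hJ, zero_mul]

theorem prob_canonical_upper_bound (d : ℕ) (hd : 1 ≤ d)
    (J : Matrix (Fin d × Fin d) (Fin d × Fin d) ℂ)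
    (hJ : J.IsHermitian) (hJ0 : J ≠ 0)
    (hTr2 : ∀ j k : Fin d, ∑ l : Fin d, J (j, l) (k, l) = 0)
    (N : ℝ) (hN : 0 < N) (p : ℝ) (hp0 : 0 ≤ p) (hp1 : p ≤ 1)
    (h : ∃ (β : Matrix (Fin d) (Fin d) ℂ)
        (J_A J_B : Matrix (Fin d × Fin d) (Fin d × Fin d) ℂ),
        β.IsHermitian ∧ (β.trace).re = N ∧ J_A.PosSemidef ∧ J_B.PosSemidef ∧
        J_A - J_B = J + β ⊗ₖ (1 : Matrix (Fin d) (Fin d) ℂ) ∧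
        (1 + Real.sqrt p) * (J_B.trace).re = (1 - Real.sqrt p) * (J_A.trace).re) :
    Real.sqrt p * (frobNorm J) ^ 2 ≤ N * d * opNorm J ∧
      p ≤ (N * d * opNorm J / (frobNorm J) ^ 2) ^ 2 := by
  obtain ⟨β, A, B, -, hβ, hA, hB, hAB, hp⟩ := h
  have htrJ : J.trace = 0 := by
    simp [Matrix.trace, Fintype.sum_prod_type, hTr2]
  have htr : A.trace.re - B.trace.re = N * d := by
    have := congrArg (fun M => M.trace.re) hAB
    simpa [Matrix.trace_sub, Matrix.trace_add, Matrix.trace_kronecker, htrJ, hβ] using this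
  have hF : frobNorm J ^ 2 = (J * A).trace.re - (J * B).trace.re := by
    have := congrArg (fun M => (J * M).trace.re) hAB
    simp only [Matrix.mul_sub, Matrix.mul_add, Matrix.trace_sub, Matrix.trace_add,
      trace_mul_kronecker_one_eq_zero hTr2, add_zero, Complex.sub_re] at this
    rw [hJ.frobNorm_sq, this]
  have hbound : frobNorm J ^ 2 ≤ opNorm J * (A.trace.re + B.trace.re) := by
    have h₁ := (Complex.re_le_norm _).trans (hA.norm_trace_mul_le J)
    have h₂ := (neg_le_abs _).trans ((Complex.abs_re_le_norm _).trans (hB.norm_trace_mul_le J))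
    linarith
  have hmain : Real.sqrt p * frobNorm J ^ 2 ≤ N * d * opNorm J := by
    calc Real.sqrt p * frobNorm J ^ 2
        ≤ Real.sqrt p * (opNorm J * (A.trace.re + B.trace.re)) := by gcongr
      _ = N * d * opNorm J := by linear_combination opNorm J * hp + opNorm J * htr
  refine ⟨hmain, ?_⟩
  have hle : Real.sqrt p ≤ N * d * opNorm J / frobNorm J ^ 2 :=
    (le_div_iff₀ (pow_pos (frobNorm_pos hJ0) 2)).mpr hmain
  calc p = Real.sqrt p ^ 2 := (Real.sq_sqrt hp0).symm
    _ ≤ _ := by gcongr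
end

section
/- Let d ≥ 1 be an integer and ι a finite index set. Let (A_j)_{j∈ι} and (B_j)_{j∈ι} be families of matrices in M_d satisfying Σ_j B_j·A_j = I, Σ_j A_j†·A_j = I, and Σ_j B_j·B_j† = I. Then B_j† = A_j for every j ∈ ι. (Lemma S1: the Cauchy–Schwarz equality argument identifying the left and right circuit blocks.) -/
open Matrix

/-- A family of complex matrices whose Gram matrices sum to zero vanishes. -/
theorem eq_zero_of_sum_conjTranspose_mul_self_eq_zero {m n ι : Type*} [Fintype m] [Fintype n]
    [Fintype ι] (C : ι → Matrix m n ℂ) (h : ∑ j, (C j)ᴴ * C j = 0) (j : ι) : C j = 0 := by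
  open scoped ComplexOrder in
  have htr : ∑ j, ((C j)ᴴ * C j).trace = 0 := by
    rw [← Matrix.trace_sum, h, Matrix.trace_zero]
  rw [Finset.sum_eq_zero_iff_of_nonneg
    fun j _ => (Matrix.posSemidef_conjTranspose_mul_self (C j)).trace_nonneg] at htr
  exact Matrix.trace_conjTranspose_mul_self_eq_zero_iff.mp (htr j (Finset.mem_univ j))

theorem left_right_blocks_equal (d : ℕ) (hd : 1 ≤ d)
    (ι : Type*) [Fintype ι]
    (A B : ι → Matrix (Fin d) (Fin d) ℂ)
    (h1 : ∑ j, B j * A j = 1)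
    (h2 : ∑ j, (A j)ᴴ * A j = 1)
    (h3 : ∑ j, B j * (B j)ᴴ = 1) :
    ∀ j, (B j)ᴴ = A j := by
  have h4 : ∑ j, (A j)ᴴ * (B j)ᴴ = 1 := by
    simpa [Matrix.conjTranspose_sum] using congrArg Matrix.conjTranspose h1
  have h5 : ∑ j, ((B j)ᴴ - A j)ᴴ * ((B j)ᴴ - A j) = 0 := by
    simp [sub_mul, mul_sub, Finset.sum_sub_distrib, h1, h2, h3, h4]
  exact fun j => sub_eq_zero.mp
    (eq_zero_of_sum_conjTranspose_mul_self_eq_zero (fun j => (B j)ᴴ - A j) h5 j)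
end

section
/- Let d ≥ 1 be an integer, J a Hermitian d²×d² matrix, Γ a PSD d²×d² matrix whose partial trace over the second tensor factor equals the d×d identity (Σ_l Γ[(j,l),(k,l)] = δ_{j,k}), and β ∈ M_d Hermitian such that J + β ⊗ I is PSD. Then Re(tr β) ≥ −Re(tr(J·Γ)). (Weak duality for the query-complexity SDP: every dual-feasible Γ certifies a lower bound on tr β.) -/
open Matrix
open scoped Kronecker ComplexOrder MatrixOrder

/-- The trace of a product of two positive semidefinite complex matrices is nonnegative. -/
theorem Matrix.PosSemidef.trace_mul_nonneg_complex {n : Type*} [Fintype n]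
    {A B : Matrix n n ℂ} (hA : A.PosSemidef) (hB : B.PosSemidef) : 0 ≤ (A * B).trace := by
  classical
  obtain ⟨C, rfl⟩ := CStarAlgebra.nonneg_iff_eq_star_mul_self.mp hB.nonneg
  rw [← Matrix.mul_assoc, Matrix.trace_mul_comm, ← Matrix.mul_assoc]
  exact (hA.mul_mul_conjTranspose_same C).trace_nonneg

/-- If the partial trace of `Γ` over the second factor is the identity, then pairing `Γ` with
`β ⊗ 1` gives the trace of `β`. -/
theorem Matrix.trace_kronecker_one_mul {m n R : Type*} [Fintype m] [Fintype n] [DecidableEq m]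
    [DecidableEq n] [CommSemiring R] (β : Matrix m m R) (Γ : Matrix (m × n) (m × n) R)
    (hΓ : ∀ j k, ∑ l, Γ (j, l) (k, l) = if j = k then 1 else 0) :
    ((β ⊗ₖ (1 : Matrix n n R)) * Γ).trace = β.trace := by
  have h (i : m) : ∑ l, ∑ k, β i k * Γ (k, l) (i, l) = β i i := by
    rw [Finset.sum_comm]
    simp [← Finset.mul_sum, hΓ]
  simp [Matrix.trace, Matrix.mul_apply, Fintype.sum_prod_type, Matrix.one_apply, h]

theorem sdp_weak_duality (d : ℕ) (hd : 1 ≤ d)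
    (J : Matrix (Fin d × Fin d) (Fin d × Fin d) ℂ) (hJ : J.IsHermitian)
    (Γ : Matrix (Fin d × Fin d) (Fin d × Fin d) ℂ) (hΓ : Γ.PosSemidef)
    (hTr2 : ∀ j k : Fin d, ∑ l : Fin d, Γ (j, l) (k, l) = if j = k then 1 else 0)
    (β : Matrix (Fin d) (Fin d) ℂ) (hβ : β.IsHermitian)
    (hpsd : (J + β ⊗ₖ (1 : Matrix (Fin d) (Fin d) ℂ)).PosSemidef) :
    (β.trace).re ≥ -((J * Γ).trace).re := by
  have h := (Complex.le_def.mp (hpsd.trace_mul_nonneg_complex hΓ)).1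
  rw [Matrix.add_mul, Matrix.trace_add, Matrix.trace_kronecker_one_mul β Γ hTr2,
    Complex.add_re, Complex.zero_re] at h
  linarith
end

section
/- Let m ≥ 1 and let A and B be PSD m×m complex matrices, X = A − B, and let λ_1,…,λ_m be the real eigenvalues of the Hermitian matrix X (with multiplicity). Then Re(tr A) ≥ Σ_i max(λ_i, 0) and Re(tr B) ≥ Σ_i max(−λ_i, 0). (Any decomposition of a Hermitian matrix as a difference of PSD matrices has traces dominating the traces of its positive and negative parts.) -/
open Matrix
open scoped ComplexOrder

theorem Matrix.trace_conjTranspose_mul_mul_unitary {n R : Type*} [Fintype n] [DecidableEq n]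
    [CommRing R] [StarRing R] (U : unitaryGroup n R) (M : Matrix n n R) :
    ((U : Matrix n n R)ᴴ * M * U).trace = M.trace := by
  rw [trace_mul_cycle, ← star_eq_conjTranspose, mem_unitaryGroup_iff.1 U.2, one_mul]

theorem Matrix.IsHermitian.conjTranspose_eigenvectorUnitary_mul_mul {n : Type*} [Fintype n]
    [DecidableEq n] {X : Matrix n n ℂ} (hX : X.IsHermitian) :
    (hX.eigenvectorUnitary : Matrix n n ℂ)ᴴ * X * hX.eigenvectorUnitary =
      diagonal (fun i => (hX.eigenvalues i : ℂ)) := by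
  have h := hX.conjStarAlgAut_star_eigenvectorUnitary
  rw [Unitary.conjStarAlgAut_star_apply] at h
  exact h

theorem psd_decomposition_trace_bounds (m : ℕ) (hm : 1 ≤ m)
    (A B : Matrix (Fin m) (Fin m) ℂ)
    (hA : A.PosSemidef) (hB : B.PosSemidef) :
    (∑ i, max ((hA.1.sub hB.1).eigenvalues i) 0) ≤ (A.trace).re ∧
    (∑ i, max (-((hA.1.sub hB.1).eigenvalues i)) 0) ≤ (B.trace).re := by
  set hX := hA.1.sub hB.1
  set U := hX.eigenvectorUnitary
  have hdiag (i : Fin m) : (((U : Matrix (Fin m) (Fin m) ℂ)ᴴ * A * U) i i).re -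
      (((U : Matrix (Fin m) (Fin m) ℂ)ᴴ * B * U) i i).re = hX.eigenvalues i := by
    have h := congr_fun₂ hX.conjTranspose_eigenvectorUnitary_mul_mul i i
    rw [mul_sub, sub_mul, Matrix.sub_apply, diagonal_apply_eq] at h
    simpa using congrArg Complex.re h
  have hnonneg {M : Matrix (Fin m) (Fin m) ℂ} (hM : M.PosSemidef) (i : Fin m) :
      0 ≤ (((U : Matrix (Fin m) (Fin m) ℂ)ᴴ * M * U) i i).re :=
    (Complex.le_def.1 (hM.conjTranspose_mul_mul_same (U : Matrix (Fin m) (Fin m) ℂ)).diag_nonneg).1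
  rw [← trace_conjTranspose_mul_mul_unitary U A, ← trace_conjTranspose_mul_mul_unitary U B]
  simp only [trace, diag_apply, Complex.re_sum]
  constructor <;> refine Finset.sum_le_sum fun i _ => max_le ?_ ?_ <;>
    linarith [hdiag i, hnonneg hA i, hnonneg hB i]
end

section
/- Let m ≥ 1 and let X be a Hermitian m×m complex matrix with real eigenvalues λ_1,…,λ_m (with multiplicity). Set t⁺ = Σ_i max(λ_i, 0) and t⁻ = Σ_i max(−λ_i, 0), and assume tr X has nonnegative real part and t⁺ > 0. Then t⁻/t⁺ is the least element of the set { Re(tr B)/Re(tr A) : A, B are PSD m×m matrices with A − B = X and Re(tr A) ≠ 0 }. (The trace-ratio minimization used to bound success probabilities: the minimum of tr J_B / tr J_A over PSD decompositions equals |Σχ_k|/|Σλ_j|.) -/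
open Matrix
open scoped ComplexOrder

/-- In any decomposition `X = A - B` with `A`, `B` positive semidefinite, the trace of `A` is at
least the sum of the positive parts of the eigenvalues of `X`. -/
theorem Matrix.IsHermitian.sum_max_eigenvalues_le_trace_re {n : Type*} [Fintype n] [DecidableEq n]
    {X A B : Matrix n n ℂ} (hX : X.IsHermitian) (hA : A.PosSemidef) (hB : B.PosSemidef)
    (hAB : A - B = X) : ∑ i, max (hX.eigenvalues i) 0 ≤ A.trace.re := by
  let U : Matrix n n ℂ := (hX.eigenvectorUnitary : Matrix n n ℂ)
  have hUU : U * Uᴴ = 1 := Unitary.coe_mul_star_self hX.eigenvectorUnitary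
  have hdiag : Uᴴ * X * U = diagonal (RCLike.ofReal ∘ hX.eigenvalues) := by
    have h := hX.conjStarAlgAut_star_eigenvectorUnitary
    rw [Unitary.conjStarAlgAut_apply] at h
    simpa [star_eq_conjTranspose] using h
  have htrace : A.trace = (Uᴴ * A * U).trace := by
    rw [trace_mul_cycle, hUU, one_mul]
  rw [htrace, trace, Complex.re_sum]
  refine Finset.sum_le_sum fun i _ ↦ ?_
  have ha := (Complex.nonneg_iff.1 ((hA.conjTranspose_mul_mul_same U).diag_nonneg (i := i))).1
  have hb := (Complex.nonneg_iff.1 ((hB.conjTranspose_mul_mul_same U).diag_nonneg (i := i))).1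
  have hab : (Uᴴ * A * U) i i - (Uᴴ * B * U) i i = (hX.eigenvalues i : ℂ) := by
    rw [← sub_apply, ← sub_mul, ← mul_sub, hAB, hdiag]
    simp
  have hre := congrArg Complex.re hab
  rw [Complex.sub_re, Complex.ofReal_re] at hre
  rw [diag_apply]
  exact max_le (by linarith) ha

/-- A matrix unitarily similar to a nonnegative real diagonal matrix is positive semidefinite, and
its trace is the sum of the diagonal entries. -/
theorem Matrix.posSemidef_trace_unitary_conj_diagonal {n : Type*} [Fintype n] [DecidableEq n]
    (U : unitaryGroup n ℂ) {d : n → ℝ} (hd : ∀ i, 0 ≤ d i) :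
    ((U : Matrix n n ℂ) * diagonal (fun i ↦ (d i : ℂ)) * (U : Matrix n n ℂ)ᴴ).PosSemidef ∧
    ((U : Matrix n n ℂ) * diagonal (fun i ↦ (d i : ℂ)) * (U : Matrix n n ℂ)ᴴ).trace.re
      = ∑ i, d i := by
  have hUU : (U : Matrix n n ℂ)ᴴ * U = 1 := Unitary.coe_star_mul_self U
  constructor
  · refine PosSemidef.mul_mul_conjTranspose_same (PosSemidef.diagonal fun i ↦ ?_) _
    exact Complex.zero_le_real.2 (hd i)
  · rw [trace_mul_cycle, hUU, one_mul, trace_diagonal, Complex.re_sum]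
    simp

theorem trace_ratio_minimization (m : ℕ) (hm : 1 ≤ m)
    (X : Matrix (Fin m) (Fin m) ℂ) (hX : X.IsHermitian)
    (tp tm : ℝ)
    (htp : tp = ∑ i, max (hX.eigenvalues i) 0)
    (htm : tm = ∑ i, max (-(hX.eigenvalues i)) 0)
    (htr : 0 ≤ (X.trace).re) (htp0 : 0 < tp) :
    IsLeast { r : ℝ | ∃ A B : Matrix (Fin m) (Fin m) ℂ,
        A.PosSemidef ∧ B.PosSemidef ∧ A - B = X ∧ (A.trace).re ≠ 0 ∧
        r = (B.trace).re / (A.trace).re }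
      (tm / tp) := by
  have hsub : tp - tm = X.trace.re := by
    rw [htp, htm, ← Finset.sum_sub_distrib, hX.trace_eq_sum_eigenvalues, Complex.re_sum]
    refine Finset.sum_congr rfl fun i _ ↦ ?_
    exact max_zero_sub_max_neg_zero_eq_self _
  constructor
  · obtain ⟨hA, hAtr⟩ := posSemidef_trace_unitary_conj_diagonal hX.eigenvectorUnitary
      (d := fun i ↦ max (hX.eigenvalues i) 0) fun i ↦ le_max_right _ _
    obtain ⟨hB, hBtr⟩ := posSemidef_trace_unitary_conj_diagonal hX.eigenvectorUnitary
      (d := fun i ↦ max (-hX.eigenvalues i) 0) fun i ↦ le_max_right _ _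
    rw [← htp] at hAtr
    rw [← htm] at hBtr
    refine ⟨_, _, hA, hB, ?_, hAtr ▸ htp0.ne', by rw [hAtr, hBtr]⟩
    conv_rhs => rw [hX.spectral_theorem, Unitary.conjStarAlgAut_apply]
    rw [← sub_mul, ← mul_sub, diagonal_sub, ← star_eq_conjTranspose]
    congr 3
    ext i
    rw [← Complex.ofReal_sub, Function.comp_apply]
    congr 1
    exact max_zero_sub_max_neg_zero_eq_self _
  · rintro r ⟨A, B, hA, hB, hAB, -, rfl⟩
    have hle : tp ≤ A.trace.re := htp ▸ hX.sum_max_eigenvalues_le_trace_re hA hB hAB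
    have htrAB : A.trace.re - B.trace.re = X.trace.re := by
      rw [← hAB, trace_sub, Complex.sub_re]
    rw [div_le_div_iff₀ htp0 (htp0.trans_le hle)]
    nlinarith [mul_nonneg htr (sub_nonneg.2 hle)]
end

section
/- Let d ≥ 2 be an integer. Then d − 1 is the least element of the set of all Re(tr β) over Hermitian β ∈ M_d for which there exists a family of matrices B′_{j,k} ∈ M_d (indexed by j ∈ {1,…,d−1}, k ∈ {0,…,d−1}) with tr B′_{j,k} = 0 for all j, k, such that −(1/d)·Σ_{k=1}^{d−1} ((Z†)ᵏ ⊗ Zᵏ) + (1/√d)·Σ_{j=1}^{d−1} Σ_{k=0}^{d−1} (Xʲ·(Z†)ᵏ) ⊗ B′_{j,k} + β ⊗ I is PSD. (The SDP value for inversion restricted to the subgroup of diagonal unitaries equals d − 1.) -/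
open Matrix
open scoped Kronecker ComplexOrder

/-- The clock matrix: diagonal with entries `ω^j` for `ω = exp(2πi/d)`. -/
noncomputable def clockZ (d : ℕ) : Matrix (Fin d) (Fin d) ℂ :=
  Matrix.diagonal fun j => Complex.exp (2 * Real.pi * Complex.I / d) ^ (j : ℕ)

/-- The cyclic shift matrix: `X[j,k] = 1` iff `j = k + 1 (mod d)`. -/
noncomputable def shiftX (d : ℕ) : Matrix (Fin d) (Fin d) ℂ :=
  Matrix.of fun j k => if (j : ℕ) = ((k : ℕ) + 1) % d then 1 else 0

theorem shiftX_pow_apply {d : ℕ} (n : ℕ) (a b : Fin d) :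
    (shiftX d ^ n) a b = if (a : ℕ) = ((b : ℕ) + n) % d then 1 else 0 := by
  induction n generalizing a with
  | zero => simp [Matrix.one_apply, Fin.ext_iff, Nat.mod_eq_of_lt b.isLt]
  | succ n ih =>
    have hpos : 0 < d := b.pos
    rw [pow_succ', Matrix.mul_apply,
      Finset.sum_eq_single (⟨((b : ℕ) + n) % d, Nat.mod_lt _ hpos⟩ : Fin d)]
    · rw [ih, if_pos rfl, mul_one]
      simp [shiftX, add_assoc]
    · intro c _ hc
      rw [ih, if_neg (fun h => hc (Fin.ext h)), mul_zero]
    · simp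

theorem shiftX_pow_apply_self {d n : ℕ} (hn : n ∈ Finset.Ico 1 d) (a : Fin d) :
    (shiftX d ^ n) a a = 0 := by
  rw [shiftX_pow_apply, if_neg]
  intro h
  obtain ⟨h1, h2⟩ := Finset.mem_Ico.mp hn
  have ha := a.isLt
  rcases lt_or_ge ((a : ℕ) + n) d with h3 | h3
  · rw [Nat.mod_eq_of_lt h3] at h
    omega
  · rw [Nat.mod_eq_sub_mod h3, Nat.mod_eq_of_lt (by omega)] at h
    omega

theorem shiftX_pow_mul_clockZ_conjTranspose_pow_apply_self {d n : ℕ} (hn : n ∈ Finset.Ico 1 d)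
    (k : ℕ) (a : Fin d) : (shiftX d ^ n * (clockZ d)ᴴ ^ k) a a = 0 := by
  rw [clockZ, Matrix.diagonal_conjTranspose, Matrix.diagonal_pow, Matrix.mul_diagonal,
    shiftX_pow_apply_self hn, zero_mul]

theorem sum_star_pow_mul_pow {d : ℕ} {ω : ℂ} (hω : IsPrimitiveRoot ω d) (a b : Fin d) :
    ∑ k ∈ Finset.Ico 1 d, star (ω ^ (a : ℕ)) ^ k * (ω ^ (b : ℕ)) ^ k =
      (if a = b then (d : ℂ) else 0) - 1 := by
  have hpos : 0 < d := a.pos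
  have hstar : ∀ n : ℕ, star (ω ^ n) * ω ^ n = 1 := fun n => by
    have h := Complex.normSq_eq_conj_mul_self (z := ω ^ n)
    rw [Complex.star_def, ← h, Complex.normSq_eq_norm_sq, norm_pow,
      hω.norm'_eq_one hpos.ne']
    simp
  set z : ℂ := star (ω ^ (a : ℕ)) * ω ^ (b : ℕ) with hz
  have hrange : ∑ k ∈ Finset.range d, z ^ k = if a = b then (d : ℂ) else 0 := by
    split_ifs with h
    · rw [hz, h, hstar]
      simp
    · have hz1 : z ≠ 1 := fun h1 => h <| Fin.ext <| hω.pow_inj a.isLt b.isLt <| by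
        have h2 : ω ^ (a : ℕ) * z = ω ^ (b : ℕ) := by
          rw [hz, ← mul_assoc, mul_comm (ω ^ (a : ℕ)), hstar, one_mul]
        rw [← h2, h1, mul_one]
      have hzd : z ^ d = 1 := by
        rw [hz, mul_pow, ← star_pow, ← pow_mul, ← pow_mul, mul_comm, mul_comm (a : ℕ),
          mul_comm (b : ℕ), pow_mul, pow_mul, hω.pow_eq_one]
        simp
      rw [geom_sum_eq hz1, hzd, sub_self, zero_div]
  rw [← hrange, Finset.range_eq_Ico, Finset.sum_eq_sum_Ico_succ_bot hpos]
  simp [hz, mul_pow]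

theorem neg_inv_smul_sum_clockZ_kronecker (d : ℕ) :
    -(((1 : ℂ) / d) • ∑ k ∈ Finset.Ico 1 d, ((clockZ d)ᴴ ^ k) ⊗ₖ (clockZ d ^ k)) =
      Matrix.diagonal fun p : Fin d × Fin d => (1 : ℂ) / d - if p.1 = p.2 then 1 else 0 := by
  ext ⟨a, b⟩ ⟨a', b'⟩
  have hd : d ≠ 0 := a.pos.ne'
  have hsum := sum_star_pow_mul_pow (Complex.isPrimitiveRoot_exp d hd) a b
  simp only [clockZ, Matrix.diagonal_conjTranspose, Matrix.diagonal_pow,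
    Matrix.diagonal_kronecker_diagonal, Matrix.neg_apply, Matrix.smul_apply, Matrix.sum_apply,
    Matrix.diagonal_apply, smul_eq_mul]
  by_cases h : ((a, b) : Fin d × Fin d) = (a', b')
  · simp only [h, if_true]
    obtain ⟨rfl, rfl⟩ := Prod.mk.inj h
    simp only [Pi.pow_apply, Pi.star_apply]
    rw [hsum]
    have : (d : ℂ) ≠ 0 := Nat.cast_ne_zero.mpr hd
    split_ifs <;> field_simp <;> ring
  · simp [h]

theorem diagonal_unitary_inversion_sdp (d : ℕ) (hd : 2 ≤ d) :
    IsLeast { t : ℝ | ∃ β : Matrix (Fin d) (Fin d) ℂ, β.IsHermitian ∧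
        ∃ B' : ℕ → ℕ → Matrix (Fin d) (Fin d) ℂ,
          (∀ j ∈ Finset.Ico 1 d, ∀ k ∈ Finset.range d, (B' j k).trace = 0) ∧
          (-(((1 : ℂ)/d) • ∑ k ∈ Finset.Ico 1 d,
                (((clockZ d)ᴴ) ^ k) ⊗ₖ ((clockZ d) ^ k))
            + ((1 : ℂ)/(Real.sqrt d : ℂ)) • ∑ j ∈ Finset.Ico 1 d,
                ∑ k ∈ Finset.range d,
                  ((shiftX d) ^ j * ((clockZ d)ᴴ) ^ k) ⊗ₖ B' j k
            + β ⊗ₖ (1 : Matrix (Fin d) (Fin d) ℂ)).PosSemidef ∧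
          t = (β.trace).re }
      ((d : ℝ) - 1) := by
  have hd0 : (d : ℂ) ≠ 0 := Nat.cast_ne_zero.mpr (by omega)
  have hd0' : (d : ℝ) ≠ 0 := Nat.cast_ne_zero.mpr (by omega)
  rw [neg_inv_smul_sum_clockZ_kronecker]
  constructor
  · refine ⟨(1 - (1 : ℂ) / d) • 1, ?_, fun _ _ => 0, fun _ _ _ _ => by simp, ?_, ?_⟩
    · simp [Matrix.IsHermitian, Matrix.conjTranspose_smul]
    · have h : ((1 - (1 : ℂ) / d) • (1 : Matrix (Fin d) (Fin d) ℂ)) ⊗ₖ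
          (1 : Matrix (Fin d) (Fin d) ℂ) = Matrix.diagonal fun _ => 1 - (1 : ℂ) / d := by
        rw [Matrix.smul_kronecker, Matrix.one_kronecker_one, Matrix.smul_one_eq_diagonal]
      simp only [Matrix.kronecker_zero, Finset.sum_const_zero, smul_zero, add_zero]
      rw [h, Matrix.diagonal_add, Matrix.posSemidef_diagonal_iff]
      intro p
      split_ifs <;> simp
    · have h : ((1 - (1 : ℂ) / d) • (1 : Matrix (Fin d) (Fin d) ℂ)).trace =
          (((d : ℝ) - 1 : ℝ) : ℂ) := by
        rw [Matrix.trace_smul, Matrix.trace_one, Fintype.card_fin, smul_eq_mul]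
        push_cast
        field_simp
      rw [h, Complex.ofReal_re]
  · rintro t ⟨β, -, B', -, hM, rfl⟩
    have hdiag : ∀ a : Fin d, 1 - 1 / (d : ℝ) ≤ (β a a).re := fun a => by
      have hz : (∑ j ∈ Finset.Ico 1 d, ∑ k ∈ Finset.range d,
          (shiftX d ^ j * (clockZ d)ᴴ ^ k) ⊗ₖ B' j k) (a, a) (a, a) = 0 := by
        simp only [Matrix.sum_apply]
        refine Finset.sum_eq_zero fun j hj => Finset.sum_eq_zero fun k _ => ?_
        rw [Matrix.kronecker_apply, shiftX_pow_mul_clockZ_conjTranspose_pow_apply_self hj,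
          zero_mul]
      have h := hM.diag_nonneg (i := (a, a))
      rw [Matrix.add_apply, Matrix.add_apply, Matrix.smul_apply, hz] at h
      have hre := (Complex.le_def.mp h).1
      have hcast : ((1 : ℂ) / d).re = 1 / (d : ℝ) := by
        rw [← Complex.ofReal_re (1 / (d : ℝ))]
        push_cast
        rfl
      simp only [Matrix.diagonal_apply_eq, if_true, smul_zero, add_zero, Matrix.kronecker_apply,
        Matrix.one_apply_eq, mul_one, Complex.add_re, Complex.sub_re, Complex.one_re,
        Complex.zero_re, hcast] at hre
      linarith
    calc (d : ℝ) - 1 = ∑ _a : Fin d, (1 - 1 / (d : ℝ)) := by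
          rw [Finset.sum_const, Finset.card_univ, Fintype.card_fin, nsmul_eq_mul]
          field_simp
      _ ≤ ∑ a, (β a a).re := Finset.sum_le_sum fun a _ => hdiag a
      _ = β.trace.re := by simp [Matrix.trace]
end
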